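/- Let n ≥ 5 and let p ≤ q ≤ n be primes. Then the alternating group Alt_n can be generated by a Sylow p-subgroup together with a Sylow q-subgroup; that is, there exist a Sylow p-subgroup P and a Sylow q-subgroup Q of Alt_n with ⟨P, Q⟩ = Alt_n. -/

import Mathlib

/-- A subgroup `H` of `G` is intravariant if every automorphism of `G` maps `H`
to a conjugate of `H`. -/
def IsIntravariant {G : Type*} [Group G] (H : Subgroup G) : Prop :=
  ∀ a : MulAut G, ∃ g : G,
    H.map a.toMonoidHom = H.map (MulAut.conj g).toMonoidHom

/-- A group is a `π`-group if every prime dividing its order lies in `π`. -/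
def IsPiGroup (π : Set ℕ) (H : Type*) [Group H] : Prop :=
  ∀ p : ℕ, p.Prime → p ∣ Nat.card H → p ∈ π

section SylowGeneration

open Equiv Equiv.Perm MulAction
open scoped Pointwise

theorem isThreeCycle_commutator {α : Type*} [Fintype α] [DecidableEq α] {f g : Perm α} {x : α}
    (hf : f x ≠ x) (hg : g x ≠ x) (h : ∀ y, f y ≠ y → g y ≠ y → y = x) :
    (f * (g * f⁻¹ * g⁻¹)).IsThreeCycle := by
  have hgg : g (g x) ≠ g x := fun e => hg (g.injective e)
  have hfg : f (g x) = g x := by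
    by_contra hc
    exact hg (h _ hc hgg)
  have hcomm : Commute (swap x (g x) * g) f := by
    apply Perm.Disjoint.commute
    intro y
    by_cases hy : f y = y
    · exact Or.inr hy
    left
    by_cases hyx : y = x
    · simp [hyx]
    · have hgy : g y = y := by
        by_contra hc
        exact hyx (h y hy hc)
      rw [Perm.mul_apply, hgy, swap_apply_of_ne_of_ne hyx]
      rintro rfl
      exact hy hfg
  have key : g * f⁻¹ * g⁻¹ = swap x (g x) * f⁻¹ * swap x (g x) := by
    have h1 : swap x (g x) * g * f⁻¹ = f⁻¹ * (swap x (g x) * g) := (hcomm.inv_right).eq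
    calc g * f⁻¹ * g⁻¹ = swap x (g x) * (swap x (g x) * g * f⁻¹) * g⁻¹ := by
          simp [mul_assoc]
      _ = _ := by rw [h1]; simp [mul_assoc]
  have h2 : f * (g * f⁻¹ * g⁻¹) = swap (g x) (f x) * swap (g x) x := by
    have h3 : f * swap x (g x) * f⁻¹ = swap (f x) (g x) := by
      rw [← swap_apply_apply, hfg]
    rw [key, ← mul_assoc, ← mul_assoc, h3, swap_comm (f x), swap_comm x]
  rw [h2]
  refine isThreeCycle_swap_mul_swap_same (fun e => ?_) hg hf
  exact hf (f.injective (by rw [← e, hfg]))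

theorem smul_eq_of_isBlock_of_isCycle {α : Type*} [Finite α]
    {H : Subgroup (Perm α)} {B : Set α} (hB : IsBlock H B) (hBn : B.Nontrivial) (g : H)
    (hg : (g : Perm α).IsCycle) (hp : (orderOf (g : Perm α)).Prime) : g • B = B := by
  by_contra hne
  have hdis := (isBlock_iff_smul_eq_or_disjoint.1 hB g).resolve_left hne
  have hmov : ∀ z ∈ B, (g : Perm α) z ≠ z := fun z hz e =>
    Set.disjoint_left.1 hdis ⟨z, hz, e⟩ hz
  obtain ⟨x, hx, y, hy, hxy⟩ := hBn
  obtain ⟨i, hi⟩ := hg.sameCycle (hmov x hx) (hmov y hy)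
  have hmem : g ^ i ∈ stabilizer H B := by
    refine (isBlock_iff_smul_eq_or_disjoint.1 hB (g ^ i)).resolve_right fun hd => ?_
    exact Set.disjoint_left.1 hd ⟨x, hx, hi⟩ hy
  have hcop : IsCoprime i (orderOf g : ℤ) := by
    rw [← Subgroup.orderOf_coe]
    refine IsCoprime.symm ((Nat.prime_iff_prime_int.1 hp).coprime_iff_not_dvd.2 fun hd => hxy ?_)
    rw [orderOf_dvd_iff_zpow_eq_one] at hd
    rw [← hi, hd]; rfl
  obtain ⟨a, b, hab⟩ := hcop
  have : g = (g ^ i) ^ a := by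
    rw [← zpow_mul, mul_comm, eq_sub_of_add_eq hab, zpow_sub, mul_comm b, zpow_mul]
    simp
  apply hne
  rw [this]
  exact zpow_mem hmem a

theorem isPreprimitive_closure {α : Type*} [Fintype α] [DecidableEq α] {S : Set (Perm α)}
    (htrans : IsPretransitive (Subgroup.closure S) α)
    (hS : ∀ s ∈ S, (s.IsCycle ∧ (orderOf s).Prime) ∨ s.support.card ≤ 4)
    {c : Perm α} (hcS : c ∈ Subgroup.closure S) (hc : c.IsCycle) (hcp : (orderOf c).Prime)
    (hc3 : 3 ≤ orderOf c) : IsPreprimitive (Subgroup.closure S) α := by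
  refine ⟨fun {B} hB => ?_⟩
  by_cases hBs : B.Subsingleton
  · exact Or.inl hBs
  right
  rw [Set.not_subsingleton_iff] at hBs
  have hcard : 3 ≤ B.ncard := by
    obtain ⟨x, hx⟩ := hBs.nonempty
    obtain ⟨y, hy⟩ := hc.nonempty_support
    obtain ⟨h, rfl⟩ := exists_smul_eq (Subgroup.closure S) x y
    have hB' : IsBlock (Subgroup.closure S) (h • B) := hB.translate h
    have hst := smul_eq_of_isBlock_of_isCycle hB'
      (hBs.image (MulAction.injective h)) ⟨c, hcS⟩ hc hcp
    have hpow : ∀ k : ℕ, (c ^ k) (h • x) ∈ h • B := by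
      intro k
      induction k with
      | zero => exact ⟨x, hx, rfl⟩
      | succ k ih =>
        rw [pow_succ', ← hst]
        exact ⟨_, ih, rfl⟩
    have hsub : (c.support : Set α) ⊆ h • B := by
      intro z hz
      obtain ⟨k, hk⟩ := hc.exists_pow_eq (mem_support.1 hy) (mem_support.1 hz)
      rw [← hk]
      exact hpow k
    have := Set.ncard_le_ncard hsub
    rw [Set.ncard_coe_finset, ← hc.orderOf] at this
    have h2 : (h • B).ncard = B.ncard := Set.ncard_image_of_injective _ (MulAction.injective h)
    omega
  have hle : Subgroup.closure S ≤
      (stabilizer (Subgroup.closure S) B).map (Subgroup.closure S).subtype := by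
    rw [Subgroup.closure_le]
    intro s hs
    refine ⟨⟨s, Subgroup.subset_closure hs⟩, ?_, rfl⟩
    rcases hS s hs with h | h
    · exact smul_eq_of_isBlock_of_isCycle hB hBs _ h.1 h.2
    · refine (isBlock_iff_smul_eq_or_disjoint.1 hB _).resolve_right fun hd => ?_
      set g : Subgroup.closure S := ⟨s, Subgroup.subset_closure hs⟩
      have hsub : B ∪ g • B ⊆ (s.support : Set α) := by
        rintro z (hz | ⟨z, hz, rfl⟩)
        · refine mem_support.2 fun e => Set.disjoint_left.1 hd ⟨z, hz, e⟩ hz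
        · refine mem_support.2 fun e => Set.disjoint_left.1 hd ⟨z, hz, rfl⟩ ?_
          have : s z = z := s.injective e
          change s z ∈ B
          rwa [this]
      have h1 := Set.ncard_le_ncard hsub
      rw [Set.ncard_union_eq hd.symm, Set.ncard_coe_finset] at h1
      have h2 : (g • B).ncard = B.ncard := Set.ncard_image_of_injective _ (MulAction.injective g)
      omega
  obtain ⟨x, hx⟩ := hBs.nonempty
  rw [Set.eq_univ_iff_forall]
  intro y
  obtain ⟨h, rfl⟩ := exists_smul_eq (Subgroup.closure S) x y
  obtain ⟨k, hk, hkh⟩ := hle h.2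
  have : k = h := Subtype.ext hkh
  subst this
  rw [← (hk : k • B = B)]
  exact ⟨x, hx, rfl⟩

theorem alternatingGroup_le_of_swap_mul_swap_mem {α : Type*} [Fintype α] [DecidableEq α]
    {H : Subgroup (Perm α)} (hH : IsPreprimitive H α)
    {c : Perm α} (hcH : c ∈ H) (hc : c.IsCycle) (hcp : (orderOf c).Prime)
    (hc3 : 3 ≤ orderOf c) (hcard : orderOf c + 2 ≤ Fintype.card α)
    {u v x y : α} (huv : u ≠ v) (hux : u ≠ x) (huy : u ≠ y) (hvx : v ≠ x) (hvy : v ≠ y)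
    (hxy : x ≠ y) (hw : swap u v * swap x y ∈ H) : alternatingGroup α ≤ H := by
  classical
  have hsupp := hc.orderOf
  have hcompl : ((c.support : Set α)ᶜ).ncard + orderOf c = Fintype.card α := by
    rw [hsupp, add_comm, ← Nat.card_eq_fintype_card, ← Set.ncard_coe_finset,
      Set.ncard_add_ncard_compl]
  have htr := isPretransitive_of_isCycle_mem hc hcH
  have hpr : IsPreprimitive (fixingSubgroup H ((c.support : Set α)ᶜ))
      (SubMulAction.ofFixingSubgroup H ((c.support : Set α)ᶜ)) := by
    apply IsPreprimitive.of_prime_card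
    convert! hcp
    rw [Nat.card_eq_fintype_card, Fintype.card_subtype, hsupp]
    apply congr_arg
    ext x
    simp [SubMulAction.mem_ofFixingSubgroup_iff]
  obtain ⟨m, hm⟩ : ∃ m, ((c.support : Set α)ᶜ).ncard = m + 1 :=
    ⟨_, (Nat.sub_add_cancel (by omega)).symm⟩
  have hmul := hH.isMultiplyPreprimitive hm (by rw [Nat.card_eq_fintype_card]; omega) hpr
  have h3 := isMultiplyPreprimitive_of_le H α (m := 3) (n := m + 2) hmul (by omega) (by
    rw [ENat.card_eq_coe_fintype_card]; norm_cast; omega)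
  have hK := h3.isPreprimitive_ofFixingSubgroup (M := H) (s := {x, y}) (by
    rw [Set.encard_pair hxy]; norm_num)
  have hu : u ∈ SubMulAction.ofFixingSubgroup H ({x, y} : Set α) := by
    simp [SubMulAction.mem_ofFixingSubgroup_iff, hux, huy]
  have hv : v ∈ SubMulAction.ofFixingSubgroup H ({x, y} : Set α) := by
    simp [SubMulAction.mem_ofFixingSubgroup_iff, hvx, hvy]
  set B : Set (SubMulAction.ofFixingSubgroup H ({x, y} : Set α)) := {⟨u, hu⟩, ⟨v, hv⟩} with hBdef
  have hnb : ¬ IsBlock (fixingSubgroup H ({x, y} : Set α)) B := by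
    intro hb
    rcases hb.subsingleton_or_eq_univ with h | h
    · have := h (Set.mem_insert _ _) (Set.mem_insert_of_mem _ rfl)
      exact huv (congrArg Subtype.val this)
    · have hall : (Finset.univ : Finset α) ⊆ {u, v, x, y} := by
        intro z _
        by_cases hz : z ∈ SubMulAction.ofFixingSubgroup H ({x, y} : Set α)
        · have : (⟨z, hz⟩ : SubMulAction.ofFixingSubgroup H ({x, y} : Set α)) ∈ B := by
            rw [h]; trivial
          rcases this with h | h
          · have := congrArg Subtype.val h
            simp at this
            simp [this]
          · have := congrArg Subtype.val h
            simp at this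
            simp [this]
        · simp [SubMulAction.mem_ofFixingSubgroup_iff] at hz
          simp only [Finset.mem_insert, Finset.mem_singleton]
          tauto
      have := (Finset.card_le_card hall).trans Finset.card_le_four
      rw [Finset.card_univ] at this
      omega
  rw [isBlock_iff_smul_eq_or_disjoint] at hnb
  push Not at hnb
  obtain ⟨k, hkne, hkd⟩ := hnb
  have hkx : (k : H).1 x = x := k.2 ⟨x, by simp⟩
  have hky : (k : H).1 y = y := k.2 ⟨y, by simp⟩
  set σ : Perm α := (k : H).1 with hσ
  have hσH : σ ∈ H := (k : H).2
  have hw' : swap (σ u) (σ v) * swap x y ∈ H := by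
    have : swap (σ u) (σ v) * swap x y = σ * (swap u v * swap x y) * σ⁻¹ := by
      have hxy' : swap x y = σ * swap x y * σ⁻¹ := by rw [← swap_apply_apply, hkx, hky]
      conv_lhs => rw [swap_apply_apply, hxy']
      simp [mul_assoc]
    rw [this]
    exact H.mul_mem (H.mul_mem hσH hw) (H.inv_mem hσH)
  have hprod : swap u v * swap (σ u) (σ v) ∈ H := by
    have : swap u v * swap (σ u) (σ v) =
        swap u v * swap x y * (swap (σ u) (σ v) * swap x y)⁻¹ := by
      simp [mul_assoc]
    rw [this]
    exact H.mul_mem hw (H.inv_mem hw')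
  have hσuv : σ u ≠ σ v := fun e => huv (σ.injective e)
  have himg : k • B = {k • ⟨u, hu⟩, k • ⟨v, hv⟩} := by
    rw [hBdef, Set.smul_set_insert, Set.smul_set_singleton]
  have hval : ∀ z hz, ((k • (⟨z, hz⟩ : SubMulAction.ofFixingSubgroup H ({x, y} : Set α)) :
    SubMulAction.ofFixingSubgroup H ({x, y} : Set α)) : α) = σ z := fun _ _ => rfl
  have hne' : ¬ (σ u = u ∧ σ v = v) ∧ ¬ (σ u = v ∧ σ v = u) := by
    constructor
    · rintro ⟨h1, h2⟩
      apply hkne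
      rw [himg, hBdef]
      congr 1
      · exact Subtype.ext h1
      · congr 1; exact Subtype.ext h2
    · rintro ⟨h1, h2⟩
      apply hkne
      rw [himg, hBdef]
      refine Eq.trans ?_ (Set.pair_comm _ _)
      congr 1
      · exact Subtype.ext h1
      · congr 1; exact Subtype.ext h2
  have hmeet : σ u = u ∨ σ u = v ∨ σ v = u ∨ σ v = v := by
    rw [Set.not_disjoint_iff] at hkd
    obtain ⟨z, hz1, hz2⟩ := hkd
    rw [himg] at hz1
    rcases hz1 with rfl | rfl <;> rcases hz2 with h | h <;>
      have := congrArg Subtype.val h <;> rw [hval] at this <;> tauto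
  have hthree : (swap u v * swap (σ u) (σ v)).IsThreeCycle := by
    rcases hmeet with h | h | h | h
    · rw [h] at hσuv ⊢
      exact isThreeCycle_swap_mul_swap_same huv hσuv (fun e => hne'.1 ⟨h, e.symm⟩)
    · rw [h] at hσuv ⊢
      rw [swap_comm u v]
      exact isThreeCycle_swap_mul_swap_same huv.symm hσuv (fun e => hne'.2 ⟨h, e.symm⟩)
    · rw [h] at hσuv ⊢
      rw [swap_comm _ u]
      exact isThreeCycle_swap_mul_swap_same huv hσuv.symm (fun e => hne'.2 ⟨e.symm, h⟩)
    · rw [h] at hσuv ⊢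
      rw [swap_comm u v, swap_comm _ v]
      exact isThreeCycle_swap_mul_swap_same huv.symm hσuv.symm (fun e => hne'.1 ⟨e.symm, h⟩)
  exact alternatingGroup_le_of_isPreprimitive_of_isThreeCycle_mem hH hthree hprod

theorem isPGroup_closure_of_commute {G : Type*} [Group G] {p : ℕ} {S : Set G}
    (hS : ∀ s ∈ S, ∀ t ∈ S, s * t = t * s) (hp : ∀ s ∈ S, s ^ p = 1) :
    IsPGroup p (Subgroup.closure S) := by
  have := Subgroup.isMulCommutative_closure hS
  rintro ⟨g, hg⟩
  refine ⟨1, Subtype.ext ?_⟩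
  change g ^ p ^ 1 = 1
  rw [pow_one]
  induction hg using Subgroup.closure_induction with
  | mem x hx => exact hp x hx
  | one => simp
  | mul x y hx hy hxp hyp =>
    have : Commute x y := setLike_mul_comm hx hy
    rw [this.mul_pow, hxp, hyp, one_mul]
  | inv x hx hxp => rw [inv_pow, hxp, inv_one]

theorem sign_eq_one_of_pow_eq_one {α : Type*} [Fintype α] [DecidableEq α] {p : ℕ} (hp : Odd p)
    {f : Perm α} (hf : f ^ p = 1) : sign f = 1 := by
  have h := congrArg sign hf
  rw [map_pow, map_one] at h
  rcases Int.units_eq_one_or (sign f) with h1 | h1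
  · exact h1
  · rw [h1, hp.neg_one_pow] at h
    exact absurd h (by decide)

theorem exists_sylow_sup_eq_top {α : Type*} [Fintype α] [DecidableEq α] {p q : ℕ}
    {S T : Set (Perm α)} (hS : ∀ s ∈ S, sign s = 1) (hT : ∀ s ∈ T, sign s = 1)
    (hSp : IsPGroup p (Subgroup.closure S)) (hTq : IsPGroup q (Subgroup.closure T))
    (h : alternatingGroup α ≤ Subgroup.closure (S ∪ T)) :
    ∃ (P : Sylow p (alternatingGroup α)) (Q : Sylow q (alternatingGroup α)),
      (P : Subgroup (alternatingGroup α)) ⊔ (Q : Subgroup _) = ⊤ := by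
  have hS' : Subgroup.closure S ≤ alternatingGroup α :=
    (Subgroup.closure_le _).2 fun s hs => mem_alternatingGroup.2 (hS s hs)
  have hT' : Subgroup.closure T ≤ alternatingGroup α :=
    (Subgroup.closure_le _).2 fun s hs => mem_alternatingGroup.2 (hT s hs)
  obtain ⟨P, hP⟩ := (hSp.comap_subtype (K := alternatingGroup α)).exists_le_sylow
  obtain ⟨Q, hQ⟩ := (hTq.comap_subtype (K := alternatingGroup α)).exists_le_sylow
  refine ⟨P, Q, top_le_iff.1 (le_trans ?_ (sup_le_sup hP hQ))⟩
  rw [Subgroup.comap_subtype, Subgroup.comap_subtype, ← Subgroup.subgroupOf_sup hS' hT',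
    ← Subgroup.closure_union, Subgroup.subgroupOf_eq_top.2 h]

theorem isPretransitive_closure {α : Type*} {S : Set (Perm α)} (x₀ : α)
    (h : ∀ Z : Set α, x₀ ∈ Z → (∀ s ∈ S, ∀ z, s z ∈ Z ↔ z ∈ Z) → ∀ z, z ∈ Z) :
    IsPretransitive (Subgroup.closure S) α := by
  refine (isPretransitive_iff_orbit_eq_univ (a := x₀)).2 (Set.eq_univ_of_forall
    (h _ (mem_orbit_self x₀) fun s hs z => ?_))
  let g : Subgroup.closure S := ⟨s, Subgroup.subset_closure hs⟩
  refine ⟨fun h => ?_, fun h => mem_orbit_of_mem_orbit g h⟩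
  have := mem_orbit_of_mem_orbit g⁻¹ h
  rwa [show g⁻¹ • s z = z from inv_smul_smul g z] at this

/-- The cycle `a ↦ a + 1 ↦ ⋯ ↦ a + m - 1 ↦ a` on `Fin n`. -/
def segCycle (n a m : ℕ) : Perm (Fin n) :=
  if h : 2 ≤ m ∧ a + m ≤ n then Fin.cycleIcc ⟨a, by omega⟩ ⟨a + m - 1, by omega⟩ else 1

section segCycle

variable {n a m : ℕ}

theorem segCycle_val (hm : 2 ≤ m) (hn : a + m ≤ n) (x : Fin n) :
    (segCycle n a m x : ℕ) =
      if (x : ℕ) < a ∨ a + m ≤ x then (x : ℕ)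
      else if (x : ℕ) + 1 = a + m then a else (x : ℕ) + 1 := by
  have : NeZero n := ⟨by omega⟩
  rw [segCycle, dif_pos ⟨hm, hn⟩]
  by_cases h1 : (x : ℕ) < a
  · rw [Fin.cycleIcc_of_lt (Fin.lt_def.2 h1), if_pos (Or.inl h1)]
  by_cases h2 : a + m ≤ x
  · rw [Fin.cycleIcc_of_gt (Fin.lt_def.2 (show a + m - 1 < x by omega)), if_pos (Or.inr h2)]
  rw [if_neg (by omega)]
  rw [Fin.cycleIcc_of_le_of_le (Fin.le_def.2 (not_lt.1 h1))
    (Fin.le_def.2 (show (x : ℕ) ≤ a + m - 1 by omega))]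
  by_cases h3 : (x : ℕ) + 1 = a + m
  · rw [if_pos h3, if_pos (Fin.ext (show (x : ℕ) = a + m - 1 by omega))]
  · rw [if_neg h3,
      if_neg (fun h => h3 (by have : (x : ℕ) = a + m - 1 := congrArg Fin.val h; omega)),
      Fin.val_add_one_of_lt']
    omega

theorem isCycle_segCycle (hm : 2 ≤ m) (hn : a + m ≤ n) : (segCycle n a m).IsCycle := by
  rw [segCycle, dif_pos ⟨hm, hn⟩]
  exact Fin.isCycle_cycleIcc (Fin.lt_def.2 (show a < a + m - 1 by omega))

theorem orderOf_segCycle (hm : 2 ≤ m) (hn : a + m ≤ n) : orderOf (segCycle n a m) = m := by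
  rw [segCycle, dif_pos ⟨hm, hn⟩, ← lcm_cycleType,
    Fin.cycleType_cycleIcc_of_lt (Fin.lt_def.2 (show a < a + m - 1 by omega))]
  simp
  omega

theorem segCycle_pow (n a m : ℕ) : segCycle n a m ^ m = 1 := by
  by_cases h : 2 ≤ m ∧ a + m ≤ n
  · conv_lhs => rw [← orderOf_segCycle h.1 h.2]
    rw [orderOf_segCycle h.1 h.2, ← orderOf_dvd_iff_pow_eq_one, orderOf_segCycle h.1 h.2]
  · rw [segCycle, dif_neg h, one_pow]

theorem segCycle_apply_eq_self (x : Fin n) (h : (x : ℕ) < a ∨ a + m ≤ x) :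
    segCycle n a m x = x := by
  by_cases hm : 2 ≤ m ∧ a + m ≤ n
  · rw [Fin.ext_iff, segCycle_val hm.1 hm.2, if_pos h]
  · rw [segCycle, dif_neg hm, one_apply]

theorem commute_segCycle {b : ℕ} (h : a = b ∨ a + m ≤ b ∨ b + m ≤ a) :
    Commute (segCycle n a m) (segCycle n b m) := by
  rcases eq_or_ne a b with rfl | hab
  · rfl
  refine Perm.Disjoint.commute fun x => ?_
  by_contra! hx
  have h1 := mt (segCycle_apply_eq_self x) hx.1
  have h2 := mt (segCycle_apply_eq_self x) hx.2
  omega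

theorem commute_segCycle_mul (n m i j : ℕ) :
    Commute (segCycle n (i * m) m) (segCycle n (j * m) m) := by
  refine commute_segCycle ?_
  rcases lt_trichotomy i j with h | rfl | h
  · exact Or.inr (Or.inl (by rw [← Nat.succ_mul]; exact Nat.mul_le_mul_right m h))
  · exact Or.inl rfl
  · exact Or.inr (Or.inr (by rw [← Nat.succ_mul]; exact Nat.mul_le_mul_right m h))

/-- A set invariant under a segment cycle is constant along the segment. -/
theorem segCycle_mem_iff (hm : 2 ≤ m) (hn : a + m ≤ n) {Z : Set (Fin n)}
    (hZ : ∀ z, segCycle n a m z ∈ Z ↔ z ∈ Z) {x y : Fin n} (hx : a ≤ x) (hx' : (x : ℕ) < a + m)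
    (hy : a ≤ y) (hy' : (y : ℕ) < a + m) : x ∈ Z ↔ y ∈ Z := by
  have key : ∀ i (hi : i < m), (⟨a + i, by omega⟩ : Fin n) ∈ Z ↔ (⟨a, by omega⟩ : Fin n) ∈ Z := by
    intro i
    induction i with
    | zero => intro _; rfl
    | succ i ih =>
      intro hi
      rw [← ih (by omega), ← hZ ⟨a + i, by omega⟩]
      have : segCycle n a m ⟨a + i, by omega⟩ = ⟨a + (i + 1), by omega⟩ := by
        rw [Fin.ext_iff, segCycle_val hm hn, if_neg (by simp; omega), if_neg (by simp; omega)]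
        simp; omega
      rw [this]
  have hx2 : x = ⟨a + (x - a), by omega⟩ := Fin.ext (by simp; omega)
  have hy2 : y = ⟨a + (y - a), by omega⟩ := Fin.ext (by simp; omega)
  rw [hx2, hy2, key _ (by omega), key _ (by omega)]

end segCycle

theorem segCycle_val_cases {n a m : ℕ} (hm : 2 ≤ m) (hn : a + m ≤ n) (x : Fin n) :
    (((x : ℕ) < a ∨ a + m ≤ x) ∧ (segCycle n a m x : ℕ) = x) ∨
    (x + 1 = a + m ∧ (segCycle n a m x : ℕ) = a) ∨
    (a ≤ x ∧ x + 1 < a + m ∧ (segCycle n a m x : ℕ) = x + 1) := by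
  rw [segCycle_val hm hn x]
  split_ifs <;> omega

theorem swap_val_cases {n i j : ℕ} (hi : i < n) (hj : j < n) (x : Fin n) :
    ((x : ℕ) = i ∧ (swap (⟨i, hi⟩ : Fin n) ⟨j, hj⟩ x : ℕ) = j) ∨
    ((x : ℕ) = j ∧ (swap (⟨i, hi⟩ : Fin n) ⟨j, hj⟩ x : ℕ) = i) ∨
    ((x : ℕ) ≠ i ∧ (x : ℕ) ≠ j ∧ (swap (⟨i, hi⟩ : Fin n) ⟨j, hj⟩ x : ℕ) = x) := by
  rw [swap_apply_def]
  split_ifs <;> simp_all [Fin.ext_iff]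

theorem alternatingGroup_le_of_isThreeCycle {α : Type*} [Fintype α] [DecidableEq α]
    {S : Set (Perm α)} (htrans : IsPretransitive (Subgroup.closure S) α)
    (hS : ∀ s ∈ S, (s.IsCycle ∧ (orderOf s).Prime) ∨ s.support.card ≤ 4)
    {f : Perm α} (hf : f.IsThreeCycle) (hfS : f ∈ Subgroup.closure S) :
    alternatingGroup α ≤ Subgroup.closure S :=
  alternatingGroup_le_of_isPreprimitive_of_isThreeCycle_mem
    (isPreprimitive_closure htrans hS hfS hf.isCycle (by rw [hf.orderOf]; exact Nat.prime_three)
      (by rw [hf.orderOf])) hf hfS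

theorem card_support_swap_mul_swap_le {α : Type*} [Fintype α] [DecidableEq α] (a b c d : α) :
    (swap a b * swap c d).support.card ≤ 4 := by
  refine (Finset.card_le_card ?_).trans (Finset.card_le_four (a := a) (b := b) (c := c) (d := d))
  intro x hx
  rw [mem_support, mul_apply] at hx
  by_contra h
  simp only [Finset.mem_insert, Finset.mem_singleton, not_or] at h
  rw [swap_apply_of_ne_of_ne h.2.2.1 h.2.2.2, swap_apply_of_ne_of_ne h.1 h.2.1] at hx
  exact hx rfl

theorem exists_sylow_of_two_segCycle {n p q : ℕ} (hp : p.Prime) (hp2 : p ≠ 2) (hq : q.Prime)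
    (hpq : p ≤ q) (hqn : q ≤ n) (hn : n + 2 ≤ p + q) (hpn : p ≠ n) :
    ∃ (P : Sylow p (alternatingGroup (Fin n))) (Q : Sylow q (alternatingGroup (Fin n))),
      (P : Subgroup (alternatingGroup (Fin n))) ⊔ (Q : Subgroup _) = ⊤ := by
  have hp3 : 3 ≤ p := by have := hp.two_le; omega
  have hdv := segCycle_val_cases (n := n) (a := 0) (m := p) (by omega) (by omega)
  have hcv := segCycle_val_cases (n := n) (a := n - q) (m := q) (by omega) (by omega)
  set d := segCycle n 0 p
  set c := segCycle n (n - q) q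
  refine exists_sylow_sup_eq_top (S := {d}) (T := {c}) ?_ ?_ ?_ ?_ ?_
  · rintro _ rfl
    exact sign_eq_one_of_pow_eq_one (hp.odd_of_ne_two hp2) (segCycle_pow _ _ _)
  · rintro _ rfl
    exact sign_eq_one_of_pow_eq_one (hq.odd_of_ne_two (by omega)) (segCycle_pow _ _ _)
  · refine isPGroup_closure_of_commute ?_ ?_
    · rintro _ rfl _ rfl; rfl
    · rintro _ rfl; exact segCycle_pow _ _ _
  · refine isPGroup_closure_of_commute ?_ ?_
    · rintro _ rfl _ rfl; rfl
    · rintro _ rfl; exact segCycle_pow _ _ _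
  have hdc : d.IsCycle := isCycle_segCycle (by omega) (by omega)
  have hcc : c.IsCycle := isCycle_segCycle (by omega) (by omega)
  have hdo : orderOf d = p := orderOf_segCycle (by omega) (by omega)
  have hco : orderOf c = q := orderOf_segCycle (by omega) (by omega)
  set S : Set (Perm (Fin n)) := {d} ∪ {c} with hS
  have hdS : d ∈ Subgroup.closure S := Subgroup.subset_closure (Or.inl rfl)
  have hcS : c ∈ Subgroup.closure S := Subgroup.subset_closure (Or.inr rfl)
  have htrans : IsPretransitive (Subgroup.closure S) (Fin n) := by
    refine isPretransitive_closure ⟨0, by omega⟩ fun Z h0 hZ z => ?_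
    have h1 : ∀ z : Fin n, (z : ℕ) < p → z ∈ Z := fun z hz =>
      (segCycle_mem_iff (a := 0) (by omega) (by omega) (hZ d (Or.inl rfl)) (by simp)
        (by simpa using hz) (by simp) (by simp; omega)).2 h0
    by_cases hz : (z : ℕ) < p
    · exact h1 z hz
    · exact (segCycle_mem_iff (a := n - q) (y := ⟨n - q, by omega⟩) (by omega) (by omega)
        (hZ c (Or.inr rfl)) (by omega) (by omega) (by simp) (by simp; omega)).2
        (h1 _ (by simp; omega))
  have hgen : ∀ s ∈ S, (s.IsCycle ∧ (orderOf s).Prime) ∨ s.support.card ≤ 4 := by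
    rintro _ (rfl | rfl)
    · exact Or.inl ⟨hdc, hdo.symm ▸ hp⟩
    · exact Or.inl ⟨hcc, hco.symm ▸ hq⟩
  rcases Nat.eq_or_lt_of_le hqn with hqn' | hqn'
  · have hf : c * d = d * c * (swap ⟨p - 1, by omega⟩ ⟨p - 2, by omega⟩ *
        swap ⟨p - 1, by omega⟩ ⟨n - 1, by omega⟩) := by
      ext x
      have h1 := swap_val_cases (n := n) (i := p - 1) (j := n - 1) (by omega) (by omega) x
      set y := swap (⟨p - 1, by omega⟩ : Fin n) ⟨n - 1, by omega⟩ x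
      have h2 := swap_val_cases (n := n) (i := p - 1) (j := p - 2) (by omega) (by omega) y
      set z := swap (⟨p - 1, by omega⟩ : Fin n) ⟨p - 2, by omega⟩ y
      change (c (d x) : ℕ) = d (c z)
      have h3 := hdv x
      have h4 := hcv (d x)
      have h5 := hcv z
      have h6 := hdv (c z)
      omega
    refine alternatingGroup_le_of_isThreeCycle htrans hgen (f := (d * c)⁻¹ * (c * d)) ?_
      (mul_mem (inv_mem (mul_mem hdS hcS)) (mul_mem hcS hdS))
    rw [hf, inv_mul_cancel_left]
    apply isThreeCycle_swap_mul_swap_same <;> rw [Ne, Fin.ext_iff] <;> simp <;> omega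
  by_cases hb : p + 1 = n
  · have hf : c = d * (swap ⟨n - 2, by omega⟩ ⟨0, by omega⟩ *
        swap ⟨n - 2, by omega⟩ ⟨n - 1, by omega⟩) := by
      ext x
      have h1 := swap_val_cases (n := n) (i := n - 2) (j := n - 1) (by omega) (by omega) x
      set y := swap (⟨n - 2, by omega⟩ : Fin n) ⟨n - 1, by omega⟩ x
      have h2 := swap_val_cases (n := n) (i := n - 2) (j := 0) (by omega) (by omega) y
      set z := swap (⟨n - 2, by omega⟩ : Fin n) ⟨0, by omega⟩ y
      change (c x : ℕ) = d z
      have h3 := hdv z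
      have h4 := hcv x
      omega
    refine alternatingGroup_le_of_isThreeCycle htrans hgen (f := d⁻¹ * c) ?_
      (mul_mem (inv_mem hdS) hcS)
    rw [hf, inv_mul_cancel_left]
    apply isThreeCycle_swap_mul_swap_same <;> rw [Ne, Fin.ext_iff] <;> simp <;> omega
  have hf : c * d = d * c * (swap ⟨p - 2, by omega⟩ ⟨p - 1, by omega⟩ *
      swap ⟨n - q - 1, by omega⟩ ⟨n - 1, by omega⟩) := by
    ext x
    have h1 := swap_val_cases (n := n) (i := n - q - 1) (j := n - 1) (by omega) (by omega) x
    set y := swap (⟨n - q - 1, by omega⟩ : Fin n) ⟨n - 1, by omega⟩ x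
    have h2 := swap_val_cases (n := n) (i := p - 2) (j := p - 1) (by omega) (by omega) y
    set z := swap (⟨p - 2, by omega⟩ : Fin n) ⟨p - 1, by omega⟩ y
    change (c (d x) : ℕ) = d (c z)
    have h3 := hdv x
    have h4 := hcv (d x)
    have h5 := hcv z
    have h6 := hdv (c z)
    omega
  refine alternatingGroup_le_of_swap_mul_swap_mem
    (isPreprimitive_closure htrans hgen hdS hdc (hdo.symm ▸ hp) (by omega)) hdS hdc
    (hdo.symm ▸ hp) (by omega) (by rw [Fintype.card_fin]; omega)
    (u := ⟨p - 2, by omega⟩) (v := ⟨p - 1, by omega⟩) (x := ⟨n - q - 1, by omega⟩)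
    (y := ⟨n - 1, by omega⟩) ?_ ?_ ?_ ?_ ?_ ?_ ?_
  iterate 6 rw [Ne, Fin.ext_iff]; simp; omega
  rw [← inv_mul_eq_iff_eq_mul.2 hf]
  exact mul_mem (inv_mem (mul_mem hdS hcS)) (mul_mem hcS hdS)

theorem exists_sylow_of_eq {n : ℕ} (hn : 5 ≤ n) (hp : n.Prime) :
    ∃ (P : Sylow n (alternatingGroup (Fin n))) (Q : Sylow n (alternatingGroup (Fin n))),
      (P : Subgroup (alternatingGroup (Fin n))) ⊔ (Q : Subgroup _) = ⊤ := by
  have hodd : Odd n := hp.odd_of_ne_two (by omega)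
  set c := segCycle n 0 n with hc
  set t : Perm (Fin n) := swap ⟨0, by omega⟩ ⟨1, by omega⟩ with ht
  have hcp : c ^ n = 1 := segCycle_pow _ _ _
  set d := t * c * t⁻¹ with hd
  have hdp : d ^ n = 1 := by rw [hd, conj_pow, hcp, mul_one, mul_inv_cancel]
  refine exists_sylow_sup_eq_top (S := {d}) (T := {c}) ?_ ?_ ?_ ?_ ?_
  · rintro _ rfl
    exact sign_eq_one_of_pow_eq_one hodd hdp
  · rintro _ rfl
    exact sign_eq_one_of_pow_eq_one hodd hcp
  · refine isPGroup_closure_of_commute ?_ ?_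
    · rintro _ rfl _ rfl; rfl
    · rintro _ rfl; exact hdp
  · refine isPGroup_closure_of_commute ?_ ?_
    · rintro _ rfl _ rfl; rfl
    · rintro _ rfl; exact hcp
  have hcc : c.IsCycle := isCycle_segCycle (by omega) (by omega)
  have hco : orderOf c = n := orderOf_segCycle (by omega) (by omega)
  have hdc : d.IsCycle := hcc.conj
  have hdo : orderOf d = n := by rw [hdc.orderOf, hd, card_support_conj, ← hcc.orderOf, hco]
  set S : Set (Perm (Fin n)) := {d} ∪ {c} with hS
  have hdS : d ∈ Subgroup.closure S := Subgroup.subset_closure (Or.inl rfl)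
  have hcS : c ∈ Subgroup.closure S := Subgroup.subset_closure (Or.inr rfl)
  have htrans : IsPretransitive (Subgroup.closure S) (Fin n) := by
    refine isPretransitive_closure ⟨0, by omega⟩ fun Z h0 hZ z => ?_
    exact (segCycle_mem_iff (a := 0) (m := n) (by omega) (by omega) (hZ c (Or.inr rfl)) (by simp)
        (by simp) (by simp) (by simp; omega)).2 h0
  have hgen : ∀ s ∈ S, (s.IsCycle ∧ (orderOf s).Prime) ∨ s.support.card ≤ 4 := by
    rintro _ (rfl | rfl)
    · exact Or.inl ⟨hdc, by rwa [hdo]⟩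
    · exact Or.inl ⟨hcc, by rwa [hco]⟩
  refine alternatingGroup_le_of_isThreeCycle htrans hgen (f := d * c⁻¹) ?_
    (mul_mem hdS (inv_mem hcS))
  have hct : c * t⁻¹ * c⁻¹ = swap ⟨1, by omega⟩ ⟨2, by omega⟩ := by
    have hv := segCycle_val (n := n) (a := 0) (m := n) (by omega) (by omega)
    rw [ht, swap_inv, ← swap_apply_apply]
    congr 1 <;> rw [Fin.ext_iff, hv, if_neg (by simp; omega), if_neg (by simp; omega)]
  have hf : d * c⁻¹ = swap ⟨1, by omega⟩ ⟨0, by omega⟩ * swap ⟨1, by omega⟩ ⟨2, by omega⟩ := by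
    rw [hd, mul_assoc, mul_assoc, ← mul_assoc c, hct, ht, swap_comm]
  rw [hf]
  apply isThreeCycle_swap_mul_swap_same <;> rw [Ne, Fin.ext_iff] <;> simp

theorem commute_swap_swap {α : Type*} [DecidableEq α] {a b c d : α} (hac : a ≠ c) (had : a ≠ d)
    (hbc : b ≠ c) (hbd : b ≠ d) : Commute (swap a b) (swap c d) := by
  rw [Commute, SemiconjBy, ← mul_inv_eq_iff_eq_mul, ← swap_apply_apply,
    swap_apply_of_ne_of_ne hac.symm hbc.symm, swap_apply_of_ne_of_ne had.symm hbd.symm]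

theorem swap_mul_swap_sq {α : Type*} [DecidableEq α] {a b c d : α} (hac : a ≠ c) (had : a ≠ d)
    (hbc : b ≠ c) (hbd : b ≠ d) : (swap a b * swap c d) ^ 2 = 1 := by
  rw [(commute_swap_swap hac had hbc hbd).mul_pow, pow_two, pow_two, swap_mul_self, swap_mul_self,
    one_mul]

theorem sign_swap_mul_swap {α : Type*} [Fintype α] [DecidableEq α] {a b c d : α} (hab : a ≠ b)
    (hcd : c ≠ d) : sign (swap a b * swap c d) = 1 := by
  rw [map_mul, sign_swap hab, sign_swap hcd]; rfl

/-- A segment cycle together with a double transposition moving four of its points. -/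
theorem exists_isThreeCycle_of_segCycle {n q : ℕ} (hq : 5 ≤ q) (hqn : q ≤ n)
    {H : Subgroup (Perm (Fin n))} (hc : segCycle n 0 q ∈ H)
    (hg : swap (⟨0, by omega⟩ : Fin n) ⟨2, by omega⟩ * swap ⟨1, by omega⟩ ⟨3, by omega⟩ ∈ H) :
    ∃ f ∈ H, f.IsThreeCycle := by
  set c := segCycle n 0 q
  set g : Perm (Fin n) := swap ⟨0, by omega⟩ ⟨2, by omega⟩ * swap ⟨1, by omega⟩ ⟨3, by omega⟩ with h
  refine ⟨_, mul_mem hg (mul_mem (mul_mem hc hg) (inv_mem hc)), ?_⟩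
  have hv := segCycle_val (n := n) (a := 0) (m := q) (by omega) (by omega)
  have hcv : ∀ i (hi : i + 1 < q), c ⟨i, by omega⟩ = ⟨i + 1, by omega⟩ := fun i hi => by
    rw [Fin.ext_iff, hv, if_neg (by simp; omega), if_neg (by simp; omega)]
  have hcg : c * g * c⁻¹ = swap ⟨1, by omega⟩ ⟨3, by omega⟩ * swap ⟨2, by omega⟩ ⟨4, by omega⟩ := by
    rw [h, ← conj_mul, ← swap_apply_apply, ← swap_apply_apply, hcv, hcv, hcv, hcv] <;> omega
  rw [hcg, h, mul_assoc, ← mul_assoc _ (swap _ _) (swap _ _), swap_mul_self, one_mul, swap_comm]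
  apply isThreeCycle_swap_mul_swap_same <;> rw [Ne, Fin.ext_iff] <;> simp

theorem exists_sylow_two_of_le {n q : ℕ} (hq : q.Prime) (hq5 : 5 ≤ q) (hqn : q ≤ n)
    (hn : n ≤ q + 1) :
    ∃ (P : Sylow 2 (alternatingGroup (Fin n))) (Q : Sylow q (alternatingGroup (Fin n))),
      (P : Subgroup (alternatingGroup (Fin n))) ⊔ (Q : Subgroup _) = ⊤ := by
  set c := segCycle n 0 q with hc
  set g : Perm (Fin n) :=
    swap ⟨0, by omega⟩ ⟨2, by omega⟩ * swap ⟨1, by omega⟩ ⟨3, by omega⟩ with hg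
  have hg2 : g ^ 2 = 1 := by apply swap_mul_swap_sq <;> simp
  have hgs : sign g = 1 := by apply sign_swap_mul_swap <;> simp
  obtain ⟨h, hh2, hhs, hgh, hhc, hhl⟩ : ∃ h : Perm (Fin n), h ^ 2 = 1 ∧ sign h = 1 ∧ Commute g h ∧
      h.support.card ≤ 4 ∧ (n = q + 1 → h ⟨4, by omega⟩ = ⟨n - 1, by omega⟩) := by
    by_cases hn' : n = q
    · exact ⟨1, by simp, by simp, Commute.one_right g, by simp, by omega⟩
    refine ⟨swap ⟨0, by omega⟩ ⟨2, by omega⟩ * swap ⟨4, by omega⟩ ⟨n - 1, by omega⟩, ?_, ?_, ?_,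
      card_support_swap_mul_swap_le _ _ _ _, fun _ => ?_⟩
    · apply swap_mul_swap_sq <;> rw [Ne, Fin.ext_iff] <;> simp <;> omega
    · apply sign_swap_mul_swap <;> (rw [Ne, Fin.ext_iff]; simp; try omega)
    · refine Commute.mul_left (Commute.mul_right rfl ?_) (Commute.mul_right ?_ ?_) <;>
        apply commute_swap_swap <;> rw [Ne, Fin.ext_iff] <;> simp <;> omega
    · rw [mul_apply, swap_apply_left, swap_apply_of_ne_of_ne] <;> (rw [Ne, Fin.ext_iff]; simp; omega)
  have hcc : c.IsCycle := isCycle_segCycle (by omega) (by omega)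
  have hco : orderOf c = q := orderOf_segCycle (by omega) (by omega)
  refine exists_sylow_sup_eq_top (S := {g, h}) (T := {c}) ?_ ?_ ?_ ?_ ?_
  · rintro _ (rfl | rfl) <;> assumption
  · rintro _ rfl
    exact sign_eq_one_of_pow_eq_one (hq.odd_of_ne_two (by omega)) (segCycle_pow _ _ _)
  · refine isPGroup_closure_of_commute ?_ ?_
    · rintro _ (rfl | rfl) _ (rfl | rfl)
      exacts [rfl, hgh, hgh.symm, rfl]
    · rintro _ (rfl | rfl) <;> assumption
  · refine isPGroup_closure_of_commute ?_ ?_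
    · rintro _ rfl _ rfl; rfl
    · rintro _ rfl; exact segCycle_pow _ _ _
  obtain ⟨f, hfS, hf⟩ := exists_isThreeCycle_of_segCycle hq5 hqn
    (H := Subgroup.closure ({g, h} ∪ {c})) (Subgroup.subset_closure (Or.inr rfl))
    (Subgroup.subset_closure (Or.inl (Or.inl rfl)))
  refine alternatingGroup_le_of_isThreeCycle ?_ ?_ hf hfS
  · refine isPretransitive_closure ⟨0, by omega⟩ fun Z h0 hZ z => ?_
    have h1 : ∀ z : Fin n, (z : ℕ) < q → z ∈ Z := fun z hz =>
      (segCycle_mem_iff (a := 0) (by omega) (by omega) (hZ c (Or.inr rfl)) (by simp)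
        (by simpa using hz) (by simp) (by simp; omega)).2 h0
    by_cases hz : (z : ℕ) < q
    · exact h1 z hz
    · have hz2 : z = h ⟨4, by omega⟩ := by rw [hhl (by omega)]; ext; simp; omega
      rw [hz2, hZ h (Or.inl (Or.inr rfl))]
      exact h1 _ (by simp; omega)
  · rintro _ ((rfl | rfl) | rfl)
    · exact Or.inr (card_support_swap_mul_swap_le _ _ _ _)
    · exact Or.inr hhc
    · exact Or.inl ⟨hcc, hco.symm ▸ hq⟩

theorem segCycle_two {n a : ℕ} (h : a + 2 ≤ n) :
    segCycle n a 2 = swap ⟨a, by omega⟩ ⟨a + 1, by omega⟩ := by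
  ext x
  have h1 := segCycle_val_cases (le_refl 2) h x
  have h2 := swap_val_cases (n := n) (i := a) (j := a + 1) (by omega) (by omega) x
  omega

/-- Products of two transpositions `(o + 2 * i, o + 2 * i + 1)` on `Fin n`. -/
def pairProducts (n o : ℕ) : Set (Perm (Fin n)) :=
  {f | ∃ i j, o + i * 2 + 2 ≤ n ∧ o + j * 2 + 2 ≤ n ∧
    f = segCycle n (o + i * 2) 2 * segCycle n (o + j * 2) 2}

section pairProducts

variable {n o : ℕ}

theorem sign_of_mem_pairProducts {f : Perm (Fin n)} (hf : f ∈ pairProducts n o) : sign f = 1 := by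
  obtain ⟨i, j, hi, hj, rfl⟩ := hf
  rw [segCycle_two hi, segCycle_two hj]
  apply sign_swap_mul_swap <;> simp

theorem card_support_of_mem_pairProducts {f : Perm (Fin n)} (hf : f ∈ pairProducts n o) :
    f.support.card ≤ 4 := by
  obtain ⟨i, j, hi, hj, rfl⟩ := hf
  rw [segCycle_two hi, segCycle_two hj]
  exact card_support_swap_mul_swap_le _ _ _ _

theorem commute_pair (i j : ℕ) :
    Commute (segCycle n (o + i * 2) 2) (segCycle n (o + j * 2) 2) :=
  commute_segCycle (by omega)

theorem isPGroup_closure_pairProducts (n o : ℕ) :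
    IsPGroup 2 (Subgroup.closure (pairProducts n o)) := by
  refine isPGroup_closure_of_commute ?_ ?_
  · rintro _ ⟨i, j, -, -, rfl⟩ _ ⟨k, l, -, -, rfl⟩
    exact ((commute_pair i k).mul_right (commute_pair i l)).mul_left
      ((commute_pair j k).mul_right (commute_pair j l))
  · rintro _ ⟨i, j, -, -, rfl⟩
    rw [(commute_pair i j).mul_pow, segCycle_pow, segCycle_pow, one_mul]

theorem segCycle_two_mem_iff (hn : o + 4 ≤ n) {Z : Set (Fin n)}
    (hZ : ∀ f ∈ pairProducts n o, ∀ z, f z ∈ Z ↔ z ∈ Z) {i : ℕ} (hi : o + i * 2 + 2 ≤ n)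
    (z : Fin n) : segCycle n (o + i * 2) 2 z ∈ Z ↔ z ∈ Z := by
  obtain ⟨j, hj, hij⟩ : ∃ j, o + j * 2 + 2 ≤ n ∧ i ≠ j := by
    rcases eq_or_ne i 0 with rfl | h
    · exact ⟨1, by omega, by omega⟩
    · exact ⟨0, by omega, h⟩
  by_cases hz : (z : ℕ) < o + j * 2 ∨ o + j * 2 + 2 ≤ z
  · rw [← hZ _ ⟨i, j, hi, hj, rfl⟩ z, mul_apply, segCycle_apply_eq_self z hz]
  · rw [segCycle_apply_eq_self z (by omega)]

end pairProducts

theorem isPGroup_closure_insert_of_conj_mem {G : Type*} [Group G] {p : ℕ} {S : Set G} {g : G}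
    (hS : IsPGroup p (Subgroup.closure S)) (hg : g ^ 2 = 1) (hgp : g ^ p = 1)
    (h : ∀ s ∈ S, g * s * g⁻¹ ∈ S) : IsPGroup p (Subgroup.closure (insert g S)) := by
  have hg' : IsPGroup p (Subgroup.zpowers g) := by
    rw [Subgroup.zpowers_eq_closure]
    refine isPGroup_closure_of_commute ?_ ?_
    · rintro _ rfl _ rfl; rfl
    · rintro _ rfl; exact hgp
  have hconj : ∀ x ∈ Subgroup.closure S, g * x * g⁻¹ ∈ Subgroup.closure S := by
    intro x hx
    have : (Subgroup.closure S).map (MulAut.conj g).toMonoidHom ≤ Subgroup.closure S := by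
      rw [MonoidHom.map_closure, Subgroup.closure_le]
      rintro _ ⟨s, hs, rfl⟩
      exact Subgroup.subset_closure (h s hs)
    exact this ⟨x, hx, rfl⟩
  have hnorm : Subgroup.zpowers g ≤ Subgroup.normalizer (Subgroup.closure S : Set G) := by
    rw [Subgroup.zpowers_le, Subgroup.mem_normalizer_iff]
    refine fun x => ⟨hconj x, fun hx => ?_⟩
    have := hconj _ hx
    have hgg : g * g = 1 := by rw [← pow_two, hg]
    have hgi : g⁻¹ = g := inv_eq_of_mul_eq_one_right hgg
    rwa [hgi, mul_assoc, mul_assoc, hgg, mul_one, ← mul_assoc, hgg, one_mul] at this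
  have := hg'.to_sup_of_normal_right' hS hnorm
  rwa [Subgroup.zpowers_eq_closure, ← Subgroup.closure_union, Set.singleton_union] at this

theorem exists_sylow_two_two {n : ℕ} (hn : 5 ≤ n) :
    ∃ (P : Sylow 2 (alternatingGroup (Fin n))) (Q : Sylow 2 (alternatingGroup (Fin n))),
      (P : Subgroup (alternatingGroup (Fin n))) ⊔ (Q : Subgroup _) = ⊤ := by
  set g : Perm (Fin n) :=
    swap ⟨0, by omega⟩ ⟨2, by omega⟩ * swap ⟨1, by omega⟩ ⟨3, by omega⟩ with hg
  have hg2 : g ^ 2 = 1 := by apply swap_mul_swap_sq <;> simp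
  have hgs : sign g = 1 := by apply sign_swap_mul_swap <;> simp
  have hgv : ∀ x : Fin n, ((x : ℕ) < 2 → (g x : ℕ) = x + 2) ∧
      (2 ≤ (x : ℕ) → (x : ℕ) < 4 → (g x : ℕ) + 2 = x) ∧ (4 ≤ (x : ℕ) → (g x : ℕ) = x) := by
    intro x
    have h1 := swap_val_cases (n := n) (i := 1) (j := 3) (by omega) (by omega) x
    set y := swap (⟨1, by omega⟩ : Fin n) ⟨3, by omega⟩ x
    have h2 := swap_val_cases (n := n) (i := 0) (j := 2) (by omega) (by omega) y
    have h3 : g x = swap (⟨0, by omega⟩ : Fin n) ⟨2, by omega⟩ y := rfl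
    rw [h3]
    omega
  have hconj : ∀ i, i * 2 + 2 ≤ n → ∃ j, j * 2 + 2 ≤ n ∧
      g * segCycle n (0 + i * 2) 2 * g⁻¹ = segCycle n (0 + j * 2) 2 := by
    intro i hi
    refine ⟨if i = 0 then 1 else if i = 1 then 0 else i, by split_ifs <;> omega, ?_⟩
    rw [segCycle_two (by omega), segCycle_two (by split_ifs <;> omega), ← swap_apply_apply]
    have h1 := hgv ⟨0 + i * 2, by omega⟩
    have h2 := hgv ⟨0 + i * 2 + 1, by omega⟩
    congr 1 <;> rw [Fin.ext_iff] <;> split_ifs <;> simp at h1 h2 ⊢ <;> omega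
  refine exists_sylow_sup_eq_top (S := insert g (pairProducts n 0)) (T := pairProducts n 1)
    ?_ ?_ ?_ (isPGroup_closure_pairProducts n 1) ?_
  · rintro s (rfl | hs)
    exacts [hgs, sign_of_mem_pairProducts hs]
  · exact fun s => sign_of_mem_pairProducts
  · refine isPGroup_closure_insert_of_conj_mem (isPGroup_closure_pairProducts n 0) hg2 hg2 ?_
    rintro _ ⟨i, j, hi, hj, rfl⟩
    obtain ⟨i', hi', hi2⟩ := hconj i (by omega)
    obtain ⟨j', hj', hj2⟩ := hconj j (by omega)
    exact ⟨i', j', by omega, by omega, by rw [← conj_mul, hi2, hj2]⟩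
  refine alternatingGroup_le_of_isThreeCycle (f := segCycle n (0 + 0 * 2) 2 *
    segCycle n (0 + 1 * 2) 2 * g * (segCycle n (1 + 0 * 2) 2 * segCycle n (1 + 1 * 2) 2))
    ?_ ?_ ?_ ?_
  · refine isPretransitive_closure ⟨0, by omega⟩ fun Z h0 hZ => ?_
    have hP := fun i => segCycle_two_mem_iff (o := 0) (i := i) (by omega)
      (fun f hf => hZ f (Or.inl (Or.inr hf)))
    have hQ := fun i => segCycle_two_mem_iff (o := 1) (i := i) (by omega)
      (fun f hf => hZ f (Or.inr hf))
    rintro ⟨z, hz⟩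
    induction z with
    | zero => exact h0
    | succ z ih =>
      rcases Nat.even_or_odd' z with ⟨i, rfl | rfl⟩
      · exact (segCycle_mem_iff (le_refl 2) (by omega) (hP i (by omega)) (by simp; omega)
          (by simp; omega) (by simp; omega) (by simp; omega)).2 (ih (by omega))
      · exact (segCycle_mem_iff (le_refl 2) (by omega) (hQ i (by omega)) (by simp; omega)
          (by simp; omega) (by simp; omega) (by simp; omega)).2 (ih (by omega))
  · rintro s ((rfl | hs) | hs)
    exacts [Or.inr (card_support_swap_mul_swap_le _ _ _ _),
      Or.inr (card_support_of_mem_pairProducts hs), Or.inr (card_support_of_mem_pairProducts hs)]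
  · have hf : segCycle n (0 + 0 * 2) 2 *
        segCycle n (0 + 1 * 2) 2 * g * (segCycle n (1 + 0 * 2) 2 * segCycle n (1 + 1 * 2) 2) =
        swap ⟨3, by omega⟩ ⟨0, by omega⟩ * swap ⟨3, by omega⟩ ⟨4, by omega⟩ := by
      ext x
      have a1 := segCycle_val_cases (n := n) (a := 1 + 1 * 2) (le_refl 2) (by omega) x
      set x1 := segCycle n (1 + 1 * 2) 2 x
      have a2 := segCycle_val_cases (n := n) (a := 1 + 0 * 2) (le_refl 2) (by omega) x1
      set x2 := segCycle n (1 + 0 * 2) 2 x1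
      have a3 := hgv x2
      set x3 := g x2
      have a4 := segCycle_val_cases (n := n) (a := 0 + 1 * 2) (le_refl 2) (by omega) x3
      set x4 := segCycle n (0 + 1 * 2) 2 x3
      have a5 := segCycle_val_cases (n := n) (a := 0 + 0 * 2) (le_refl 2) (by omega) x4
      have b1 := swap_val_cases (n := n) (i := 3) (j := 4) (by omega) (by omega) x
      set y := swap (⟨3, by omega⟩ : Fin n) ⟨4, by omega⟩ x
      have b2 := swap_val_cases (n := n) (i := 3) (j := 0) (by omega) (by omega) y
      change (segCycle n (0 + 0 * 2) 2 x4 : ℕ) = swap _ _ y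
      omega
    rw [hf]
    apply isThreeCycle_swap_mul_swap_same <;> simp
  · refine mul_mem (mul_mem ?_ ?_) ?_ <;> apply Subgroup.subset_closure
    · exact Or.inl (Or.inr ⟨0, 1, by omega, by omega, rfl⟩)
    · exact Or.inl (Or.inl rfl)
    · exact Or.inr ⟨0, 1, by omega, by omega, rfl⟩

theorem sub_div_lt_sub_div {q m m' : ℕ} (hq : 2 ≤ q) (h : m < m')
    (h' : ¬ (m' = m + 1 ∧ q ∣ m')) : m - m / q < m' - m' / q := by
  have e1 := Nat.div_add_mod m q
  have e2 := Nat.div_add_mod m' q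
  have l1 := Nat.mod_lt m (show 0 < q by omega)
  have l2 := Nat.mod_lt m' (show 0 < q by omega)
  have hj : m / q ≤ m' / q := Nat.div_le_div_right h.le
  obtain ⟨e, he⟩ := Nat.exists_eq_add_of_le hj
  have b1 : m / q ≤ m := Nat.div_le_self _ _
  rcases e with _ | e
  · omega
  · have h3 : q * (m' / q) = q * (m / q) + q + q * e := by rw [he]; ring
    have h4 : 2 * e ≤ q * e := Nat.mul_le_mul_right e hq
    by_contra hc
    refine h' ⟨by omega, Nat.dvd_of_mod_eq_zero (by omega)⟩

/-- The `m`-th point in an enumeration of points of consecutive blocks of length `p`, such that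
consecutive blocks of `q` positions are linked: position `m` lies in block `m - m / q`. -/
def linkPoint (p q m : ℕ) : ℕ :=
  (m - m / q) * p + if q ∣ m ∧ m ≠ 0 then 1 else 0

theorem linkPoint_div {p : ℕ} (hp : 2 ≤ p) (q m : ℕ) : linkPoint p q m / p = m - m / q := by
  refine Nat.div_eq_of_lt_le ?_ ?_ <;> rw [linkPoint]
  · omega
  · rw [Nat.succ_mul]; split_ifs <;> omega

theorem linkPoint_injective {p q : ℕ} (hp : 2 ≤ p) (hq : 2 ≤ q) :
    Function.Injective (linkPoint p q) := by
  have key : ∀ m m', m < m' → linkPoint p q m ≠ linkPoint p q m' := by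
    intro m m' h e
    have h1 : m - m / q = m' - m' / q := by rw [← linkPoint_div hp, e, linkPoint_div hp]
    have h2 : m' = m + 1 ∧ q ∣ m' := by
      by_contra hc
      exact (sub_div_lt_sub_div hq h hc).ne h1
    have h3 : q ∣ m := by
      by_contra hc
      rw [linkPoint, linkPoint, h1, if_neg (fun h => hc h.1), if_pos ⟨h2.2, by omega⟩] at e
      omega
    have h4 : q ∣ 1 := (Nat.dvd_add_right h3).1 (h2.1 ▸ h2.2)
    have := Nat.le_of_dvd one_pos h4
    omega
  intro m m' e
  rcases lt_trichotomy m m' with h | h | h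
  · exact absurd e (key _ _ h)
  · exact h
  · exact absurd e.symm (key _ _ h)

/-- The number of positions needed to link `n / p` blocks. -/
def linkLength (p q n : ℕ) : ℕ := n / p + (n / p - 1) / (q - 1)

theorem sub_div_of_lt_linkLength {p q n m : ℕ} (hq : 2 ≤ q) (hpn : 1 ≤ n / p)
    (hm : m < linkLength p q n) : m - m / q < n / p := by
  rw [linkLength] at hm
  have e1 := Nat.div_add_mod (n / p - 1) (q - 1)
  have l1 := Nat.mod_lt (n / p - 1) (show 0 < q - 1 by omega)
  have e2 := Nat.div_add_mod m q
  have l2 := Nat.mod_lt m (show 0 < q by omega)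
  set a := (n / p - 1) / (q - 1)
  set j := m / q
  obtain ⟨q', rfl⟩ : ∃ q', q = q' + 1 := ⟨q - 1, by omega⟩
  rw [Nat.add_sub_cancel] at e1
  rw [Nat.add_mul, one_mul] at e2
  by_contra hc
  have hj : a ≤ j ∨ j < a := le_or_gt a j
  rcases hj with hj | hj
  · omega
  · obtain ⟨e, he⟩ := Nat.exists_eq_add_of_lt hj
    have : q' * a = q' * j + q' * e + q' := by rw [he]; ring
    omega

theorem linkLength_add_mod_le {p q n : ℕ} (hp : 2 ≤ p) (hpq : p ≤ q) (hq : 3 ≤ q) (hqn : q ≤ n) :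
    linkLength p q n + n % p ≤ n / q * q := by
  rw [linkLength]
  have hk : 1 ≤ n / p := (Nat.one_le_div_iff (by omega)).2 (by omega)
  have hl : 1 ≤ n / q := (Nat.one_le_div_iff (by omega)).2 hqn
  have e1 := Nat.div_add_mod n p
  have l1 := Nat.mod_lt n (show 0 < p by omega)
  have e2 := Nat.div_add_mod n q
  have l2 := Nat.mod_lt n (show 0 < q by omega)
  have hd := Nat.div_mul_le_self (n / p - 1) (q - 1)
  have hd0 : n / p < q → (n / p - 1) / (q - 1) = 0 := fun h => Nat.div_eq_of_lt (by omega)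
  set k := n / p
  set r := n % p
  set l := n / q
  set d := (k - 1) / (q - 1)
  obtain ⟨p', rfl⟩ := Nat.exists_eq_add_of_le hp
  obtain ⟨k', hk'⟩ := Nat.exists_eq_add_of_le hk
  have e1' : 2 * k + p' * k + r = n := by rw [← e1]; ring
  rcases Nat.eq_or_lt_of_le hl with hl' | hl'
  · rw [← hl'] at e2 ⊢
    have hkq : k < q := by have := Nat.zero_le (p' * k); omega
    rw [hd0 hkq]
    rcases k' with _ | k'
    · omega
    · have : p' * k = p' * 2 + p' * k' := by rw [hk']; ring
      have := Nat.zero_le (p' * k')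
      omega
  · have h2q : 2 * q ≤ l * q := Nat.mul_le_mul_right q hl'
    rw [mul_comm q l] at e2
    rcases Nat.eq_zero_or_pos p' with rfl | hp'
    · rcases Nat.eq_or_lt_of_le hq with rfl | hq4
      · omega
      · have : d * 3 ≤ d * (q - 1) := Nat.mul_le_mul_left d (by omega)
        omega
    · have : d * 2 ≤ d * (q - 1) := Nat.mul_le_mul_left d (by omega)
      have : p' * k = p' + p' * k' := by rw [hk']; ring
      have : 1 * k' ≤ p' * k' := Nat.mul_le_mul_right k' hp'
      omega

/-- The conjugating permutation that links the orbits of the `p`-cycles by `q`-cycles. -/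
theorem exists_linking_perm {p q n : ℕ} (hp : 2 ≤ p) (hpq : p ≤ q) (hq : 3 ≤ q) (hqn : q ≤ n) :
    ∃ τ : Perm (Fin n),
      (∀ m : Fin n, (m : ℕ) < linkLength p q n → (τ m : ℕ) = linkPoint p q m) ∧
      (∀ m : Fin n, linkLength p q n ≤ m → (m : ℕ) < linkLength p q n + n % p →
        (τ m : ℕ) = n / p * p + (m - linkLength p q n)) ∧
      (p + q ≤ n + 1 → ∀ m : Fin n, (m : ℕ) < q → (τ m : ℕ) < p → (m : ℕ) = 0) := by
  have hk : 1 ≤ n / p := (Nat.one_le_div_iff (by omega)).2 (by omega)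
  set L := linkLength p q n with hL
  have hL1 : 1 ≤ L := hk.trans (Nat.le_add_right _ _)
  have e1 := Nat.div_add_mod' n p
  have hpk : p ≤ n / p * p := Nat.le_mul_of_pos_left p hk
  have hlt : ∀ m, m < L → linkPoint p q m < n / p * p := fun m hm => by
    rw [← Nat.div_lt_iff_lt_mul (by omega), linkPoint_div hp]
    exact sub_div_of_lt_linkLength (by omega) hk hm
  have hlow : ∀ m, m < q → linkPoint p q m = m * p := fun m hm => by
    rw [linkPoint, Nat.div_eq_of_lt hm, Nat.sub_zero, if_neg, add_zero]
    rintro ⟨h1, h2⟩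
    have := Nat.le_of_dvd (Nat.pos_of_ne_zero h2) h1
    omega
  have hge : ∀ m, m < q → linkPoint p q m < p → m = 0 := fun m hm h => by
    rw [hlow m hm] at h
    by_contra h0
    have := Nat.le_mul_of_pos_left p (Nat.pos_of_ne_zero h0)
    omega
  set f : Fin n → Fin n := fun m =>
    if h : (m : ℕ) < L then ⟨linkPoint p q m, (hlt m h).trans_le (by omega)⟩
    else if h : (m : ℕ) < L + n % p then ⟨n / p * p + (m - L), by omega⟩
    else ⟨n - m - 1 + 1 - (if m = (0 : ℕ) then 1 else 0), by split_ifs <;> omega⟩ with hf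
  set s : Finset (Fin n) := {m | (m : ℕ) < L + n % p ∨
    (L + n % p < q ∧ p + q ≤ n + 1 ∧ n < m + p)} with hs
  have hf1 : ∀ m : Fin n, (m : ℕ) < L → (f m : ℕ) = linkPoint p q m := fun m h => by
    simp [hf, h]
  have hf2 : ∀ m : Fin n, L ≤ m → (m : ℕ) < L + n % p → (f m : ℕ) = n / p * p + (m - L) :=
    fun m h h' => by simp [hf, h', h.not_gt]
  have hf3 : ∀ m : Fin n, L + n % p ≤ m → (f m : ℕ) = n - m := fun m h => by
    simp [hf, h.not_gt, show ¬ (m : ℕ) < L by omega]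
    have := m.2
    split_ifs <;> omega
  have hinj : Set.InjOn f s := by
    intro x hx y hy hxy
    simp only [hs, Finset.coe_filter, Finset.mem_univ, true_and, Set.mem_ofPred_eq] at hx hy
    rw [Fin.ext_iff] at hxy ⊢
    have key : ∀ m : Fin n, ((m : ℕ) < L ∧ (f m : ℕ) = linkPoint p q m) ∨
        (L ≤ m ∧ (m : ℕ) < L + n % p ∧ (f m : ℕ) = n / p * p + (m - L)) ∨
        (L + n % p ≤ m ∧ (f m : ℕ) = n - m) := fun m => by
      rcases lt_or_ge (m : ℕ) L with h | h
      · exact Or.inl ⟨h, hf1 m h⟩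
      rcases lt_or_ge (m : ℕ) (L + n % p) with h' | h'
      · exact Or.inr (Or.inl ⟨h, h', hf2 m h h'⟩)
      · exact Or.inr (Or.inr ⟨h', hf3 m h'⟩)
    have kx := key x
    have ky := key y
    have hx1 := hlt x
    have hy1 := hlt y
    have hx2 := hge x
    have hy2 := hge y
    have hx0 := x.2
    have hy0 := y.2
    have hxz : (x : ℕ) = 0 → linkPoint p q x = 0 := fun h => by rw [h]; simp [linkPoint]
    have hyz : (y : ℕ) = 0 → linkPoint p q y = 0 := fun h => by rw [h]; simp [linkPoint]
    have hcomp : linkPoint p q x = linkPoint p q y → (x : ℕ) = y :=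
      fun h => linkPoint_injective hp (by omega) h
    rcases kx with kx | kx | kx <;> rcases ky with ky | ky | ky <;> omega
  obtain ⟨g, hg⟩ := Finset.exists_equiv_extend_of_card_eq (t := Finset.univ) (by simp)
    (Finset.subset_univ _) hinj
  let τ : Perm (Fin n) := g.trans (Equiv.subtypeUnivEquiv (by simp))
  have hτ : ∀ m ∈ s, τ m = f m := hg
  refine ⟨τ, fun m hm => ?_, fun m hm hm' => ?_, fun hn m hm hm' => ?_⟩
  · rw [hτ m (by simp [hs]; omega), hf1 m hm]
  · rw [hτ m (by simp [hs]; omega), hf2 m hm hm']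
  · by_contra h0
    rcases lt_or_ge (m : ℕ) (L + n % p) with h | h
    · rw [hτ m (by simp [hs]; omega)] at hm'
      rcases lt_or_ge (m : ℕ) L with h1 | h1
      · rw [hf1 m h1] at hm'
        exact h0 (hge m hm hm')
      · rw [hf2 m h1 h] at hm'
        omega
    · have h1 : 0 < (τ m : ℕ) := by
        by_contra hc
        have : τ ⟨0, by omega⟩ = τ m := by
          rw [hτ ⟨0, by omega⟩ (by simp [hs]; omega), Fin.ext_iff, hf1 _ (by simp; omega)]
          simp [linkPoint]
          omega
        exact h0 (congrArg Fin.val (τ.injective this)).symm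
      have h2 : τ ⟨n - τ m, by omega⟩ = τ m := by
        rw [hτ ⟨n - τ m, by omega⟩ (by simp [hs]; omega), Fin.ext_iff, hf3 _ (by simp; omega)]
        simp
        omega
      have := congrArg Fin.val (τ.injective h2)
      simp at this
      omega

theorem mem_of_linking_perm {p q n : ℕ} (hp : 2 ≤ p) (hpq : p ≤ q) (hq : 3 ≤ q) (hqn : q ≤ n)
    {τ : Perm (Fin n)}
    (h1 : ∀ m : Fin n, (m : ℕ) < linkLength p q n → (τ m : ℕ) = linkPoint p q m)
    (h2 : ∀ m : Fin n, linkLength p q n ≤ m → (m : ℕ) < linkLength p q n + n % p →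
        (τ m : ℕ) = n / p * p + (m - linkLength p q n))
    {Z : Set (Fin n)} (h0 : (⟨0, by omega⟩ : Fin n) ∈ Z)
    (hP : ∀ x y : Fin n, (x : ℕ) / p = y / p → (x : ℕ) / p < n / p → (x ∈ Z ↔ y ∈ Z))
    (hQ : ∀ x y : Fin n, (x : ℕ) / q = y / q → (x : ℕ) / q < n / q → (τ x ∈ Z ↔ τ y ∈ Z))
    (x : Fin n) : x ∈ Z := by
  have hk : 1 ≤ n / p := (Nat.one_le_div_iff (by omega)).2 (by omega)
  have hlen := linkLength_add_mod_le hp hpq hq hqn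
  have hqn' := Nat.div_mul_le_self n q
  have e1 := Nat.div_add_mod' n p
  have hmoved : ∀ i, i < n / p → ∀ x : Fin n, (x : ℕ) / p = i → x ∈ Z := by
    intro i
    induction i with
    | zero =>
      intro hi x hx
      exact (hP x ⟨0, by omega⟩ (by simp [hx]) (by omega)).2 h0
    | succ i ih =>
      intro hi x hx
      have e2 := Nat.div_add_mod i (q - 1)
      have l2 := Nat.mod_lt i (show 0 < q - 1 by omega)
      set j := i / (q - 1) with hj
      set t := i % (q - 1)
      have hqj : (q - 1) * j + j = q * j := by
        obtain ⟨q', rfl⟩ : ∃ q', q = q' + 1 := ⟨q - 1, by omega⟩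
        rw [Nat.add_sub_cancel]; ring
      have hjk : j ≤ (n / p - 1) / (q - 1) := Nat.div_le_div_right (by omega)
      have hmL : q * j + t + 1 < linkLength p q n := by rw [linkLength]; omega
      have d1 : (q * j + t) / q = j := by
        rw [Nat.mul_add_div (by omega), Nat.div_eq_of_lt (by omega), add_zero]
      have d2 : (q * j + t + 1) / q = j := by
        rw [add_assoc, Nat.mul_add_div (by omega), Nat.div_eq_of_lt (by omega), add_zero]
      have hjl : j < n / q := by
        rw [← d2, Nat.div_lt_iff_lt_mul (by omega)]
        omega
      set m : Fin n := ⟨q * j + t, by omega⟩ with hm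
      set m' : Fin n := ⟨q * j + t + 1, by omega⟩ with hm'
      have v1 : (τ m : ℕ) / p = i := by
        rw [h1 m (by simp [hm]; omega), linkPoint_div hp]
        change q * j + t - (q * j + t) / q = i
        omega
      have v2 : (τ m' : ℕ) / p = i + 1 := by
        rw [h1 m' (by simp [hm']; omega), linkPoint_div hp]
        change q * j + t + 1 - (q * j + t + 1) / q = i + 1
        omega
      rw [hP x (τ m') (by rw [hx, v2]) (by omega), hQ m' m (by rw [hm, hm', d1, d2])
        (by rw [hm', d2]; exact hjl)]
      exact ih (by omega) _ v1
  have hmoved' : ∀ x : Fin n, (x : ℕ) < n / p * p → x ∈ Z := fun x hx =>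
    hmoved _ ((Nat.div_lt_iff_lt_mul (by omega)).2 hx) x rfl
  by_cases hx : (x : ℕ) < n / p * p
  · exact hmoved' x hx
  have hr := Nat.mod_lt n (show 0 < p by omega)
  set L := linkLength p q n with hL
  have hx0 := x.2
  have hpos : ∀ y : Fin n, n / p * p ≤ y → ∃ m : Fin n, L ≤ m ∧ (m : ℕ) < L + n % p ∧ τ m = y := by
    intro y hy
    have hy0 := y.2
    refine ⟨⟨L + (y - n / p * p), by omega⟩, by simp, by simp; omega, ?_⟩
    rw [Fin.ext_iff, h2 _ (by simp) (by simp; omega)]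
    simp; omega
  obtain ⟨m, hm1, hm2, rfl⟩ := hpos x (by omega)
  have hj : (m : ℕ) / q < n / q := (Nat.div_lt_iff_lt_mul (by omega)).2 (by omega)
  set j := (m : ℕ) / q with hjdef
  have hjq : (j + 1) * q ≤ n / q * q := Nat.mul_le_mul_right q hj
  rw [Nat.succ_mul] at hjq
  by_cases hjL : j * q < L
  · rw [hQ m ⟨j * q, by omega⟩ (by simp [Nat.mul_div_cancel _ (show 0 < q by omega), hjdef]) hj]
    apply hmoved'
    rw [h1 _ (by simpa using hjL), ← Nat.div_lt_iff_lt_mul (by omega), linkPoint_div hp]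
    exact sub_div_of_lt_linkLength (by omega) hk hjL
  · have hd : (j * q + (q - 1)) / q = j := by
      rw [mul_comm, Nat.mul_add_div (by omega), Nat.div_eq_of_lt (by omega), add_zero]
    rw [hQ m ⟨j * q + (q - 1), by omega⟩ (by simp only [hd]; rfl) hj]
    apply hmoved'
    by_contra hc
    obtain ⟨m', h3, h4, h5⟩ := hpos _ (not_lt.1 hc)
    have := congrArg Fin.val (τ.injective h5)
    simp at this
    omega

/-- The conjugates under `τ` of the cycles on consecutive blocks of length `m`. -/
def conjCycles {n : ℕ} (τ : Perm (Fin n)) (m : ℕ) : Set (Perm (Fin n)) :=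
  {s | ∃ j, j * m + m ≤ n ∧ s = τ * segCycle n (j * m) m * τ⁻¹}

section conjCycles

variable {n m : ℕ} {τ : Perm (Fin n)}

theorem pow_of_mem_conjCycles {s : Perm (Fin n)} (hs : s ∈ conjCycles τ m) : s ^ m = 1 := by
  obtain ⟨j, -, rfl⟩ := hs
  rw [conj_pow, segCycle_pow, mul_one, mul_inv_cancel]

theorem isPGroup_closure_conjCycles (τ : Perm (Fin n)) (m : ℕ) :
    IsPGroup m (Subgroup.closure (conjCycles τ m)) := by
  refine isPGroup_closure_of_commute ?_ fun s hs => pow_of_mem_conjCycles hs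
  rintro _ ⟨i, -, rfl⟩ _ ⟨j, -, rfl⟩
  rw [conj_mul, conj_mul, (commute_segCycle_mul n m i j).eq]

theorem isCycle_of_mem_conjCycles (hm : 2 ≤ m) {s : Perm (Fin n)} (hs : s ∈ conjCycles τ m) :
    s.IsCycle := by
  obtain ⟨j, hj, rfl⟩ := hs
  exact (isCycle_segCycle hm hj).conj

theorem orderOf_of_mem_conjCycles (hm : 2 ≤ m) {s : Perm (Fin n)} (hs : s ∈ conjCycles τ m) :
    orderOf s = m := by
  have h := (isCycle_of_mem_conjCycles hm hs).orderOf
  obtain ⟨j, hj, rfl⟩ := hs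
  rw [h, card_support_conj, ← (isCycle_segCycle hm hj).orderOf, orderOf_segCycle hm hj]

theorem conjCycles_mem_iff (hm : 2 ≤ m) {Z : Set (Fin n)}
    (hZ : ∀ s ∈ conjCycles τ m, ∀ z, s z ∈ Z ↔ z ∈ Z) (x y : Fin n)
    (hxy : (x : ℕ) / m = y / m) (hx : (x : ℕ) / m < n / m) : τ x ∈ Z ↔ τ y ∈ Z := by
  have e1 := Nat.div_mul_le_self n m
  have e2 := Nat.mul_le_mul_right m (Nat.succ_le_of_lt hx)
  rw [Nat.succ_mul] at e2
  have ex := Nat.div_add_mod' (x : ℕ) m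
  have ey := Nat.div_add_mod' (y : ℕ) m
  have lx := Nat.mod_lt (x : ℕ) (show 0 < m by omega)
  have ly := Nat.mod_lt (y : ℕ) (show 0 < m by omega)
  rw [← hxy] at ey
  refine segCycle_mem_iff (a := x / m * m) (Z := τ ⁻¹' Z) hm (by omega) (fun z => ?_) (by omega)
    (by omega) (by omega) (by omega)
  have := hZ _ ⟨x / m, by omega, rfl⟩ (τ z)
  simpa using this

end conjCycles

theorem exists_sylow_of_add_le {n p q : ℕ} (hp : p.Prime) (hp2 : p ≠ 2) (hq : q.Prime)
    (hpq : p ≤ q) (hn : p + q ≤ n + 1) :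
    ∃ (P : Sylow p (alternatingGroup (Fin n))) (Q : Sylow q (alternatingGroup (Fin n))),
      (P : Subgroup (alternatingGroup (Fin n))) ⊔ (Q : Subgroup _) = ⊤ := by
  have hp3 : 3 ≤ p := by have := hp.two_le; omega
  obtain ⟨τ, h1, h2, h3⟩ := exists_linking_perm (n := n) hp.two_le hpq (by omega) (by omega)
  refine exists_sylow_sup_eq_top (S := conjCycles 1 p) (T := conjCycles τ q)
    (fun s hs => sign_eq_one_of_pow_eq_one (hp.odd_of_ne_two hp2) (pow_of_mem_conjCycles hs))
    (fun s hs => sign_eq_one_of_pow_eq_one (hq.odd_of_ne_two (by omega))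
      (pow_of_mem_conjCycles hs))
    (isPGroup_closure_conjCycles _ _) (isPGroup_closure_conjCycles _ _) ?_
  have hd : segCycle n 0 p ∈ conjCycles 1 p := ⟨0, by omega, by simp⟩
  have hc : τ * segCycle n 0 q * τ⁻¹ ∈ conjCycles τ q := ⟨0, by omega, by simp⟩
  have hL : 0 < linkLength p q n :=
    Nat.lt_add_right _ (Nat.div_pos (by omega) (by omega))
  have hτ0 : τ ⟨0, by omega⟩ = ⟨0, by omega⟩ := by
    rw [Fin.ext_iff, h1 _ hL]
    simp [linkPoint]
  have hτ0' : τ⁻¹ ⟨0, by omega⟩ = ⟨0, by omega⟩ := by rw [inv_eq_iff_eq, hτ0]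
  refine alternatingGroup_le_of_isThreeCycle ?_ ?_
    (isThreeCycle_commutator (f := segCycle n 0 p) (g := τ * segCycle n 0 q * τ⁻¹)
      (x := ⟨0, by omega⟩) ?_ ?_ fun y hy hy' => ?_)
    (mul_mem (Subgroup.subset_closure (Or.inl hd))
      (mul_mem (mul_mem (Subgroup.subset_closure (Or.inr hc))
        (inv_mem (Subgroup.subset_closure (Or.inl hd))))
        (inv_mem (Subgroup.subset_closure (Or.inr hc)))))
  · exact isPretransitive_closure ⟨0, by omega⟩ fun Z h0 hZ z =>
      mem_of_linking_perm hp.two_le hpq (by omega) (by omega) h1 h2 h0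
        (conjCycles_mem_iff (τ := 1) hp.two_le fun s hs => hZ s (Or.inl hs))
        (conjCycles_mem_iff hq.two_le fun s hs => hZ s (Or.inr hs)) z
  · rintro s (hs | hs)
    · exact Or.inl ⟨isCycle_of_mem_conjCycles hp.two_le hs,
        (orderOf_of_mem_conjCycles hp.two_le hs).symm ▸ hp⟩
    · exact Or.inl ⟨isCycle_of_mem_conjCycles hq.two_le hs,
        (orderOf_of_mem_conjCycles hq.two_le hs).symm ▸ hq⟩
  · rw [Ne, Fin.ext_iff, segCycle_val hp.two_le (by omega)]
    simp
    omega
  · rw [mul_apply, mul_apply, hτ0', ← hτ0, Ne, τ.apply_eq_iff_eq, hτ0, Fin.ext_iff,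
      segCycle_val hq.two_le (by omega)]
    simp
    omega
  · have hyp : (y : ℕ) < p := by
      by_contra hyp
      exact hy (segCycle_apply_eq_self y (by omega))
    have hyq : (τ⁻¹ y : ℕ) < q := by
      by_contra hyq
      refine hy' ?_
      rw [mul_apply, mul_apply, segCycle_apply_eq_self _ (by omega)]
      simp
    have := h3 hn (τ⁻¹ y) hyq (by simpa using hyp)
    rw [← hτ0, ← inv_eq_iff_eq, Fin.ext_iff, this]

theorem exists_sylow_two_of_add_two_le {n q : ℕ} (hq : q.Prime) (hq3 : 3 ≤ q) (hn : q + 2 ≤ n) :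
    ∃ (P : Sylow 2 (alternatingGroup (Fin n))) (Q : Sylow q (alternatingGroup (Fin n))),
      (P : Subgroup (alternatingGroup (Fin n))) ⊔ (Q : Subgroup _) = ⊤ := by
  obtain ⟨τ, h1, h2, -⟩ :=
    exists_linking_perm (n := n) (le_refl 2) (by omega : 2 ≤ q) hq3 (by omega)
  refine exists_sylow_sup_eq_top (S := pairProducts n 0) (T := conjCycles τ q)
    (fun s hs => sign_of_mem_pairProducts hs)
    (fun s hs => sign_eq_one_of_pow_eq_one (hq.odd_of_ne_two (by omega))
      (pow_of_mem_conjCycles hs))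
    (isPGroup_closure_pairProducts _ _) (isPGroup_closure_conjCycles _ _) ?_
  have hc : τ * segCycle n 0 q * τ⁻¹ ∈ conjCycles τ q := ⟨0, by omega, by simp⟩
  have hcc := isCycle_of_mem_conjCycles hq.two_le hc
  have hco := orderOf_of_mem_conjCycles hq.two_le hc
  have hcS := Subgroup.subset_closure (Set.mem_union_right (pairProducts n 0) hc)
  have hw : swap (⟨0, by omega⟩ : Fin n) ⟨1, by omega⟩ * swap ⟨2, by omega⟩ ⟨3, by omega⟩ ∈
      pairProducts n 0 := by
    refine ⟨0, 1, by omega, by omega, ?_⟩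
    rw [segCycle_two, segCycle_two] <;> first | rfl | omega
  have htrans : IsPretransitive (Subgroup.closure (pairProducts n 0 ∪ conjCycles τ q)) (Fin n) :=
    isPretransitive_closure ⟨0, by omega⟩ fun Z h0 hZ z =>
      mem_of_linking_perm le_rfl (by omega) hq3 (by omega) h1 h2 h0
        (conjCycles_mem_iff (τ := 1) le_rfl (by
          rintro _ ⟨i, hi, rfl⟩ z
          have := segCycle_two_mem_iff (n := n) (o := 0) (by omega) (fun f hf => hZ f (Or.inl hf))
            (i := i) (by omega) z
          simpa using this))
        (conjCycles_mem_iff hq.two_le fun s hs => hZ s (Or.inr hs)) z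
  refine alternatingGroup_le_of_swap_mul_swap_mem
    (isPreprimitive_closure htrans ?_ hcS hcc (hco.symm ▸ hq) (by omega)) hcS hcc
    (hco.symm ▸ hq) (by omega) (by simpa [hco] using hn) ?_ ?_ ?_ ?_ ?_ ?_
    (Subgroup.subset_closure (Or.inl hw)) <;> try simp
  rintro s (hs | hs)
  · exact Or.inr (card_support_of_mem_pairProducts hs)
  · exact Or.inl ⟨isCycle_of_mem_conjCycles hq.two_le hs,
      (orderOf_of_mem_conjCycles hq.two_le hs).symm ▸ hq⟩

end SylowGeneration

theorem alternating_generated_by_sylow_p_and_sylow_q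
    (n : ℕ) (hn : 5 ≤ n) (p q : ℕ) (hp : p.Prime) (hq : q.Prime)
    (hpq : p ≤ q) (hqn : q ≤ n) :
    ∃ (P : Sylow p ↥(alternatingGroup (Fin n)))
      (Q : Sylow q ↥(alternatingGroup (Fin n))),
      (P : Subgroup ↥(alternatingGroup (Fin n))) ⊔ (Q : Subgroup _) = ⊤ := by
  rcases eq_or_ne p 2 with rfl | hp2
  · rcases eq_or_ne q 2 with rfl | hq2
    · exact exists_sylow_two_two hn
    rcases le_or_gt (q + 2) n with h | h
    · exact exists_sylow_two_of_add_two_le hq (by omega) h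
    · have hq4 : q ≠ 4 := by rintro rfl; exact absurd hq (by decide)
      exact exists_sylow_two_of_le hq (by omega) hqn (by omega)
  rcases le_or_gt (p + q) (n + 1) with h | h
  · exact exists_sylow_of_add_le hp hp2 hq hpq h
  rcases eq_or_ne p n with rfl | hpn
  · obtain rfl : q = p := by omega
    exact exists_sylow_of_eq hn hq
  · exact exists_sylow_of_two_segCycle hp hp2 hq hpq hqn (by omega) hpn
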